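/- Let F be a field, c ∈ F, and work in R = F[x,y,z] with C_1, C_2, C_3, D_1, D_2, D_3 and f, g, h as defined in the context. Then the identities C_1 − C_2 = (x^2−y^2)D_3, C_2 − C_3 = (y^2−z^2)D_1, C_3 − C_1 = (z^2−x^2)D_2 hold, and (zD_3)·f + (xD_1)·g + (yD_2)·h = 0; that is, (zD_3, xD_1, yD_2) is a syzygy on (f, g, h). -/

import Mathlib

open MvPolynomial

noncomputable section

/-- `C₃ = 4x⁴+4y⁴+(3c+9)x²y²+(5c−1)x²z²+(5c−1)y²z²+(15c+25)z⁴`. -/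
def C₃ {F : Type*} [Field F] (c : F) : MvPolynomial (Fin 3) F :=
  4 * X 0 ^ 4 + 4 * X 1 ^ 4 + C (3 * c + 9) * X 0 ^ 2 * X 1 ^ 2 +
    C (5 * c - 1) * X 0 ^ 2 * X 2 ^ 2 + C (5 * c - 1) * X 1 ^ 2 * X 2 ^ 2 +
    C (15 * c + 25) * X 2 ^ 4

/-- `C₁ = (15c+25)x⁴+4y⁴+(5c−1)x²y²+(5c−1)x²z²+(3c+9)y²z²+4z⁴`. -/
def C₁ {F : Type*} [Field F] (c : F) : MvPolynomial (Fin 3) F :=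
  C (15 * c + 25) * X 0 ^ 4 + 4 * X 1 ^ 4 + C (5 * c - 1) * X 0 ^ 2 * X 1 ^ 2 +
    C (5 * c - 1) * X 0 ^ 2 * X 2 ^ 2 + C (3 * c + 9) * X 1 ^ 2 * X 2 ^ 2 +
    4 * X 2 ^ 4

/-- `C₂ = 4x⁴+(15c+25)y⁴+(5c−1)x²y²+(3c+9)x²z²+(5c−1)y²z²+4z⁴`. -/
def C₂ {F : Type*} [Field F] (c : F) : MvPolynomial (Fin 3) F :=
  4 * X 0 ^ 4 + C (15 * c + 25) * X 1 ^ 4 + C (5 * c - 1) * X 0 ^ 2 * X 1 ^ 2 +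
    C (3 * c + 9) * X 0 ^ 2 * X 2 ^ 2 + C (5 * c - 1) * X 1 ^ 2 * X 2 ^ 2 +
    4 * X 2 ^ 4

/-- `D₃ = (15c+21)x²+(15c+21)y²+(2c−10)z²`. -/
def D₃ {F : Type*} [Field F] (c : F) : MvPolynomial (Fin 3) F :=
  C (15 * c + 21) * X 0 ^ 2 + C (15 * c + 21) * X 1 ^ 2 + C (2 * c - 10) * X 2 ^ 2

/-- `D₁ = (2c−10)x²+(15c+21)y²+(15c+21)z²`. -/
def D₁ {F : Type*} [Field F] (c : F) : MvPolynomial (Fin 3) F :=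
  C (2 * c - 10) * X 0 ^ 2 + C (15 * c + 21) * X 1 ^ 2 + C (15 * c + 21) * X 2 ^ 2

/-- `D₂ = (15c+21)x²+(2c−10)y²+(15c+21)z²`. -/
def D₂ {F : Type*} [Field F] (c : F) : MvPolynomial (Fin 3) F :=
  C (15 * c + 21) * X 0 ^ 2 + C (2 * c - 10) * X 1 ^ 2 + C (15 * c + 21) * X 2 ^ 2

/-- `f = xy(x²−y²)C₃`. -/
def kf {F : Type*} [Field F] (c : F) : MvPolynomial (Fin 3) F :=
  X 0 * X 1 * (X 0 ^ 2 - X 1 ^ 2) * C₃ c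

/-- `g = yz(y²−z²)C₁`. -/
def kg {F : Type*} [Field F] (c : F) : MvPolynomial (Fin 3) F :=
  X 1 * X 2 * (X 1 ^ 2 - X 2 ^ 2) * C₁ c

/-- `h = zx(z²−x²)C₂`. -/
def kh {F : Type*} [Field F] (c : F) : MvPolynomial (Fin 3) F :=
  X 2 * X 0 * (X 2 ^ 2 - X 0 ^ 2) * C₂ c

/-- the identities `C₁−C₂=(x²−y²)D₃`, `C₂−C₃=(y²−z²)D₁`,
`C₃−C₁=(z²−x²)D₂`, and `(zD₃)f+(xD₁)g+(yD₂)h=0`. -/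
theorem klein_cubic_syzygy {F : Type*} [Field F] (c : F) :
    C₁ c - C₂ c = (X 0 ^ 2 - X 1 ^ 2) * D₃ c ∧
    C₂ c - C₃ c = (X 1 ^ 2 - X 2 ^ 2) * D₁ c ∧
    C₃ c - C₁ c = (X 2 ^ 2 - X 0 ^ 2) * D₂ c ∧
    (X 2 * D₃ c) * kf c + (X 0 * D₁ c) * kg c + (X 1 * D₂ c) * kh c = 0 := by
  have h₃ : C₁ c - C₂ c = (X 0 ^ 2 - X 1 ^ 2) * D₃ c := by
    simp only [C₁, C₂, D₃, map_add, map_sub, map_mul, map_ofNat, map_one]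
    ring
  have h₁ : C₂ c - C₃ c = (X 1 ^ 2 - X 2 ^ 2) * D₁ c := by
    simp only [C₂, C₃, D₁, map_add, map_sub, map_mul, map_ofNat, map_one]
    ring
  have h₂ : C₃ c - C₁ c = (X 2 ^ 2 - X 0 ^ 2) * D₂ c := by
    simp only [C₃, C₁, D₂, map_add, map_sub, map_mul, map_ofNat, map_one]
    ring
  refine ⟨h₃, h₁, h₂, ?_⟩
  simp only [kf, kg, kh]
  linear_combination (-(X 0 * X 1 * X 2)) * (C₃ c * h₃ + C₁ c * h₁ + C₂ c * h₂)

end
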